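/- (Theorem 2.) Let B > 0 and let the reward be the sum throughput R(v_1, …, v_K) = p·B·Σ_{i=1}^K v_i, which is regular and bounded with Δ_l = Δ_u = p·B. Assume τ is a monotonically increasing contracting map and β ∈ (0,1]. Then the myopic policy is optimal: for every scheduling policy π, every time 1 ≤ n ≤ T, and every belief vector s ∈ [0,1]^N, V^π_n(s) ≤ W_n(sort(s)), where sort(s) is s rearranged in decreasing order. -/

import Mathlib

/-- Sort the entries of a vector in decreasing order. -/
noncomputable def sortVec (N : ℕ) (v : Fin N → ℝ) : Fin N → ℝ :=
  fun i => ((List.ofFn v).mergeSort (fun a b => decide (b ≤ a))).getD i.val 0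

/-- The first `K` entries of a vector of length `N` (for `K ≤ N`). -/
noncomputable def firstK (N K : ℕ) (v : Fin N → ℝ) : Fin K → ℝ :=
  fun k => (List.ofFn v).getD k.val 0

/-- The set of scheduled indices `{1,…,K}` (the first `K` coordinates). -/
def sched (N K : ℕ) : Finset (Fin N) := Finset.univ.filter (fun i => i.val < K)

/-- The next belief vector `[T(v_Ē), 0(|E|)]`: the entries of `v` outside the active set `E`
are sorted in decreasing order, `τ` is applied to each, and `|E|` zeros are appended. -/
noncomputable def nextVec (N : ℕ) (τ : ℝ → ℝ) (E : Finset (Fin N)) (v : Fin N → ℝ) :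
    Fin N → ℝ :=
  fun i => (((((Finset.univ \ E).sort (· ≤ ·)).map v).mergeSort
      (fun a b => decide (b ≤ a))).map τ).getD i.val 0

/-- The pseudo value function, indexed by remaining time: `W … m v` is the pseudo value
function `W_n(v)` of the paper with `m = T - n` slots remaining after the current one;
`W … 0 v = R(v_1,…,v_K)` and
`W … (m+1) v = R(v_1,…,v_K) + β·Σ_{E ⊆ {1,…,K}} (1-p)^(K-|E|) p^|E| · W … m ([T(v_Ē), 0(|E|)])`. -/
noncomputable def W (N K : ℕ) (β p : ℝ) (τ : ℝ → ℝ) (R : (Fin K → ℝ) → ℝ) :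
    ℕ → (Fin N → ℝ) → ℝ
  | 0, v => R (firstK N K v)
  | m + 1, v => R (firstK N K v) +
      β * ∑ E ∈ (sched N K).powerset,
        ((1 - p) ^ (K - E.card) * p ^ E.card) * W N K β p τ R m (nextVec N τ E v)

/-- The restriction of a belief vector `s` to a size-`K` subset `A` of its coordinates
(listed in increasing index order), as a vector of length `K`. -/
noncomputable def restr (N K : ℕ) (A : Finset (Fin N)) (s : Fin N → ℝ) : Fin K → ℝ :=
  fun k => ((A.sort (· ≤ ·)).map s).getD k.val 0

/-- The value function of a scheduling policy `pol`, indexed by remaining time: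
`Vpol … m s` is the value `V^π_n(s)` of the paper with `m = T - n` slots remaining;
`V^π_T(s) = R(s|_{π_T(s)})` and
`V^π_n(s) = R(s|_{π_n(s)}) + β·Σ_{E ⊆ π_n(s)} (1-p)^(K-|E|) p^|E| · V^π_{n+1}(s')`, where
`s'_i = 0` for `i ∈ E` and `s'_i = τ(s_i)` for `i ∉ E`. -/
noncomputable def Vpol (N K T : ℕ) (β p : ℝ) (τ : ℝ → ℝ) (R : (Fin K → ℝ) → ℝ)
    (pol : ℕ → (Fin N → ℝ) → Finset (Fin N)) : ℕ → (Fin N → ℝ) → ℝ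
  | 0, s => R (restr N K (pol T s) s)
  | m + 1, s => R (restr N K (pol (T - (m + 1)) s) s) +
      β * ∑ E ∈ (pol (T - (m + 1)) s).powerset,
        ((1 - p) ^ (K - E.card) * p ^ E.card) *
          Vpol N K T β p τ R pol m (fun i => if i ∈ E then 0 else τ (s i))

/-- Expectation of `f E` over the random subset `E` of `A` containing each element of `A`
independently with probability `p`. -/
noncomputable def activeExp {ι : Type*} (p : ℝ) (A : Finset ι) (f : Finset ι → ℝ) : ℝ :=
  ∑ E ∈ A.powerset, ((1 - p) ^ (A.card - E.card) * p ^ E.card) * f E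

/-- The belief vector following `s` when the nodes in `E` are active. -/
def stepBelief {ι : Type*} [DecidableEq ι] (τ : ℝ → ℝ) (E : Finset ι) (s : ι → ℝ) : ι → ℝ :=
  fun i => if i ∈ E then 0 else τ (s i)

/-- The value of scheduling `A` in state `s`, with per-unit reward `c` and continuation value
`F`. -/
noncomputable def actionValue {ι : Type*} [DecidableEq ι] (c β p : ℝ) (τ : ℝ → ℝ)
    (F : (ι → ℝ) → ℝ) (A : Finset ι) (s : ι → ℝ) : ℝ :=
  c * ∑ i ∈ A, s i + β * activeExp p A (fun E => F (stepBelief τ E s))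

/-- The Bellman operator: the best value over all size-`K` actions. -/
noncomputable def bellman {ι : Type*} [DecidableEq ι] (K : ℕ) (c β p : ℝ) (τ : ℝ → ℝ)
    (F : (ι → ℝ) → ℝ) (s : ι → ℝ) : ℝ :=
  ⨆ A : {A : Finset ι // A.card = K}, actionValue c β p τ F A.1 s

/-- The optimal value function with `m` slots to go. -/
noncomputable def optValue {ι : Type*} [DecidableEq ι] (K : ℕ) (c β p : ℝ) (τ : ℝ → ℝ) :
    ℕ → (ι → ℝ) → ℝ
  | 0 => fun _ => 0
  | m + 1 => bellman K c β p τ (optValue K c β p τ m)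

/-- `F` is invariant under permutations of the coordinates. -/
def IsPermInvariant {ι : Type*} (F : (ι → ℝ) → ℝ) : Prop :=
  ∀ (σ : Equiv.Perm ι) (s : ι → ℝ), F (s ∘ σ) = F s

/-- Raising one coordinate of a vector in `[0,1]^ι` raises `F` by at most `B` times the
increment. -/
def HasIncrementBound {ι : Type*} [DecidableEq ι] (B : ℝ) (F : (ι → ℝ) → ℝ) : Prop :=
  ∀ (s : ι → ℝ), (∀ i, s i ∈ Set.Icc (0 : ℝ) 1) → ∀ (i : ι), ∀ x ∈ Set.Icc (0 : ℝ) 1,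
    ∀ y ∈ Set.Icc (0 : ℝ) 1, y ≤ x →
      F (Function.update s i x) ≤ F (Function.update s i y) + B * (x - y)

section ActiveExp

variable {ι : Type*} {p : ℝ}

lemma activeExp_insert [DecidableEq ι] {A : Finset ι} {a : ι} (ha : a ∉ A)
    (f : Finset ι → ℝ) :
    activeExp p (insert a A) f
      = (1 - p) * activeExp p A f + p * activeExp p A (fun E => f (insert a E)) := by
  unfold activeExp
  rw [Finset.sum_powerset_insert ha, Finset.mul_sum, Finset.mul_sum]
  congr 1 <;> refine Finset.sum_congr rfl fun E hE => ?_
  · have h := Finset.card_le_card (Finset.mem_powerset.1 hE)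
    rw [Finset.card_insert_of_notMem ha, Nat.sub_add_comm h, pow_succ]
    ring
  · have haE : a ∉ E := fun h => ha (Finset.mem_powerset.1 hE h)
    rw [Finset.card_insert_of_notMem ha, Finset.card_insert_of_notMem haE,
      Nat.add_sub_add_right, pow_succ]
    ring

lemma activeExp_add_const (A : Finset ι) (f : Finset ι → ℝ) (c : ℝ) :
    activeExp p A (fun E => f E + c) = activeExp p A f + c := by
  have h := Finset.sum_pow_mul_eq_add_pow p (1 - p) A
  rw [add_sub_cancel, one_pow] at h
  unfold activeExp
  simp only [mul_add, Finset.sum_add_distrib, ← Finset.sum_mul]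
  simp only [mul_comm (_ ^ _) (p ^ _), h, one_mul]

lemma activeExp_mono (hp0 : 0 ≤ p) (hp1 : p ≤ 1) {A : Finset ι} {f g : Finset ι → ℝ}
    (h : ∀ E ⊆ A, f E ≤ g E) : activeExp p A f ≤ activeExp p A g :=
  Finset.sum_le_sum fun E hE => mul_le_mul_of_nonneg_left (h E (Finset.mem_powerset.1 hE))
    (mul_nonneg (pow_nonneg (sub_nonneg.2 hp1) _) (pow_nonneg hp0 _))

lemma activeExp_le_add (hp0 : 0 ≤ p) (hp1 : p ≤ 1) {A : Finset ι} {f g : Finset ι → ℝ}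
    {c : ℝ} (h : ∀ E ⊆ A, f E ≤ g E + c) : activeExp p A f ≤ activeExp p A g + c :=
  (activeExp_mono hp0 hp1 h).trans_eq (activeExp_add_const A g c)

lemma activeExp_image [DecidableEq ι] (σ : Equiv.Perm ι) (A : Finset ι)
    (f : Finset ι → ℝ) :
    activeExp p (A.image σ) f = activeExp p A (fun E => f (E.image σ)) := by
  unfold activeExp
  rw [Finset.powerset_image,
    Finset.sum_image (Finset.image_injective σ.injective).injOn]
  simp only [Finset.card_image_of_injective _ σ.injective]

end ActiveExp

section StepBelief

variable {ι : Type*} [DecidableEq ι] {τ : ℝ → ℝ}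

lemma stepBelief_mem (hτmap : ∀ x ∈ Set.Icc (0 : ℝ) 1, τ x ∈ Set.Icc (0 : ℝ) 1)
    (E : Finset ι) {s : ι → ℝ} (hs : ∀ i, s i ∈ Set.Icc (0 : ℝ) 1) (i : ι) :
    stepBelief τ E s i ∈ Set.Icc (0 : ℝ) 1 := by
  unfold stepBelief
  split_ifs
  · exact ⟨le_rfl, zero_le_one⟩
  · exact hτmap _ (hs i)

lemma stepBelief_update_of_notMem {E : Finset ι} {i : ι} (hi : i ∉ E) (s : ι → ℝ) (x : ℝ) :
    stepBelief τ E (Function.update s i x) = Function.update (stepBelief τ E s) i (τ x) := by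
  funext j
  by_cases h : j = i
  · subst h; simp [stepBelief, hi]
  · simp [stepBelief, h]

lemma stepBelief_update_of_mem {E : Finset ι} {i : ι} (hi : i ∈ E) (s : ι → ℝ) (x : ℝ) :
    stepBelief τ E (Function.update s i x) = stepBelief τ E s := by
  funext j
  by_cases h : j = i
  · subst h; simp [stepBelief, hi]
  · simp [stepBelief, h]

lemma stepBelief_image_comp (σ : Equiv.Perm ι) (E : Finset ι) (s : ι → ℝ) :
    stepBelief τ (E.image σ) s ∘ σ = stepBelief τ E (s ∘ σ) := by
  funext i
  simp [stepBelief]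

lemma stepBelief_insert_comp_swap {E : Finset ι} {i j : ι} (hi : i ∉ E) (hj : j ∉ E)
    (hij : i ≠ j) (s : ι → ℝ) :
    stepBelief τ (insert i E) s ∘ Equiv.swap i j
      = Function.update (stepBelief τ (insert j E) s) i (τ (s j)) := by
  funext k
  by_cases h : k = i
  · subst h; simp [stepBelief, hj, hij.symm]
  by_cases h' : k = j
  · subst h'; simp [stepBelief, h]
  · simp [stepBelief, h, h', Equiv.swap_apply_of_ne_of_ne h h']

end StepBelief

section Bellman

variable {ι : Type*} [DecidableEq ι] {K : ℕ} {c β p B : ℝ} {τ : ℝ → ℝ}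
  {F : (ι → ℝ) → ℝ}

lemma actionValue_le_bellman [Finite ι] {A : Finset ι} (hA : A.card = K) (s : ι → ℝ) :
    actionValue c β p τ F A s ≤ bellman K c β p τ F s :=
  le_ciSup (f := fun A : {A : Finset ι // A.card = K} => actionValue c β p τ F A.1 s)
    (Set.finite_range _).bddAbove ⟨A, hA⟩

lemma bellman_le [Fintype ι] (hK : K ≤ Fintype.card ι) {s : ι → ℝ} {b : ℝ}
    (h : ∀ A : Finset ι, A.card = K → actionValue c β p τ F A s ≤ b) :
    bellman K c β p τ F s ≤ b := by
  obtain ⟨A, -, hA⟩ := Finset.exists_subset_card_eq (s := (Finset.univ : Finset ι)) hK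
  have : Nonempty {A : Finset ι // A.card = K} := ⟨⟨A, hA⟩⟩
  exact ciSup_le fun A => h A.1 A.2

lemma IsPermInvariant.bellman [Fintype ι] (hK : K ≤ Fintype.card ι)
    (hF : IsPermInvariant F) : IsPermInvariant (bellman K c β p τ F) := by
  have key : ∀ (σ : Equiv.Perm ι) (s : ι → ℝ),
      _root_.bellman K c β p τ F (s ∘ σ) ≤ _root_.bellman K c β p τ F s := by
    intro σ s
    refine bellman_le hK fun A hA => ?_
    refine le_trans (le_of_eq ?_) (actionValue_le_bellman (A := A.image σ)
      (by rw [Finset.card_image_of_injective _ σ.injective, hA]) s)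
    unfold actionValue
    rw [activeExp_image, Finset.sum_image σ.injective.injOn]
    simp only [← stepBelief_image_comp, hF σ, Function.comp_apply]
  intro σ s
  refine le_antisymm (key σ s) ?_
  have h := key σ⁻¹ (s ∘ σ)
  rwa [show (s ∘ σ) ∘ ⇑σ⁻¹ = s by funext i; simp] at h

lemma HasIncrementBound.bellman [Fintype ι] (hK : K ≤ Fintype.card ι)
    (hβ0 : 0 ≤ β) (hβ1 : β ≤ 1) (hp0 : 0 ≤ p) (hp1 : p ≤ 1) (hB : 0 ≤ B)
    (hτmap : ∀ x ∈ Set.Icc (0 : ℝ) 1, τ x ∈ Set.Icc (0 : ℝ) 1)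
    (hτmono : MonotoneOn τ (Set.Icc 0 1))
    (hτcon : ∀ x ∈ Set.Icc (0 : ℝ) 1, ∀ y ∈ Set.Icc (0 : ℝ) 1, |τ x - τ y| ≤ |x - y|)
    (hF : HasIncrementBound B F) :
    HasIncrementBound B (bellman K (p * B) β p τ F) := by
  intro s hs i x hx y hy hyx
  refine bellman_le hK fun A hA => ?_
  suffices h : actionValue (p * B) β p τ F A (Function.update s i x)
      ≤ actionValue (p * B) β p τ F A (Function.update s i y) + B * (x - y) from
    h.trans (add_le_add_left (actionValue_le_bellman hA _) _)
  have hstep : ∀ E : Finset ι, i ∉ E → F (stepBelief τ E (Function.update s i x))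
      ≤ F (stepBelief τ E (Function.update s i y)) + B * (x - y) := by
    intro E hi
    rw [stepBelief_update_of_notMem hi, stepBelief_update_of_notMem hi]
    refine (hF _ (stepBelief_mem hτmap E hs) i _ (hτmap x hx) _ (hτmap y hy)
      (hτmono hy hx hyx)).trans ?_
    have := (le_abs_self _).trans (hτcon x hx y hy)
    rw [abs_of_nonneg (sub_nonneg.2 hyx)] at this
    gcongr
  have hd : 0 ≤ B * (x - y) := mul_nonneg hB (sub_nonneg.2 hyx)
  have hβd := mul_le_of_le_one_left hd hβ1
  unfold actionValue
  by_cases hi : i ∈ A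
  · obtain ⟨C, hiC, rfl⟩ : ∃ C, i ∉ C ∧ insert i C = A :=
      ⟨A.erase i, Finset.notMem_erase i A, Finset.insert_erase hi⟩
    rw [activeExp_insert hiC, activeExp_insert hiC, Finset.sum_insert hiC,
      Finset.sum_insert hiC]
    have h1 := activeExp_le_add hp0 hp1
      (fun E (hE : E ⊆ C) => hstep E fun h => hiC (hE h))
    simp only [stepBelief_update_of_mem (Finset.mem_insert_self i _), Function.update_self,
      Finset.sum_update_of_notMem hiC]
    have h2 := mul_le_mul_of_nonneg_left h1 (mul_nonneg hβ0 (sub_nonneg.2 hp1))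
    have h3 := mul_le_mul_of_nonneg_left hβd (sub_nonneg.2 hp1)
    linarith
  · rw [Finset.sum_update_of_notMem hi, Finset.sum_update_of_notMem hi]
    have h1 := activeExp_le_add hp0 hp1
      (fun E (hE : E ⊆ A) => hstep E fun h => hi (hE h))
    have h2 := mul_le_mul_of_nonneg_left h1 hβ0
    linarith

/-- Replacing a scheduled node by an unscheduled one with larger belief does not decrease the
value. -/
lemma actionValue_exchange (hβ0 : 0 ≤ β) (hβ1 : β ≤ 1) (hp0 : 0 ≤ p) (hp1 : p ≤ 1)
    (hB : 0 ≤ B) (hτmap : ∀ x ∈ Set.Icc (0 : ℝ) 1, τ x ∈ Set.Icc (0 : ℝ) 1)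
    (hτmono : MonotoneOn τ (Set.Icc 0 1))
    (hτcon : ∀ x ∈ Set.Icc (0 : ℝ) 1, ∀ y ∈ Set.Icc (0 : ℝ) 1, |τ x - τ y| ≤ |x - y|)
    (hsym : IsPermInvariant F) (hF : HasIncrementBound B F)
    {C : Finset ι} {i j : ι} (hi : i ∉ C) (hj : j ∉ C) (hij : i ≠ j) {s : ι → ℝ}
    (hs : ∀ i, s i ∈ Set.Icc (0 : ℝ) 1) (hle : s j ≤ s i) :
    actionValue (p * B) β p τ F (insert j C) s
      ≤ actionValue (p * B) β p τ F (insert i C) s := by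
  unfold actionValue
  rw [activeExp_insert hi, activeExp_insert hj, Finset.sum_insert hi, Finset.sum_insert hj]
  have hd : 0 ≤ B * (s i - s j) := mul_nonneg hB (sub_nonneg.2 hle)
  have h1 : activeExp p C (fun E => F (stepBelief τ (insert j E) s))
      ≤ activeExp p C (fun E => F (stepBelief τ (insert i E) s)) + B * (s i - s j) := by
    refine activeExp_le_add hp0 hp1 fun E hE => ?_
    have hiE : i ∉ E := fun h => hi (hE h)
    have hjE : j ∉ E := fun h => hj (hE h)
    rw [← hsym (Equiv.swap i j) (stepBelief τ (insert i E) s),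
      stepBelief_insert_comp_swap hiE hjE hij]
    have h := hF _ (stepBelief_mem hτmap (insert j E) hs) i _ (hτmap _ (hs i)) _
      (hτmap _ (hs j)) (hτmono (hs j) (hs i) hle)
    have hval : stepBelief τ (insert j E) s i = τ (s i) := by simp [stepBelief, hij, hiE]
    rw [← hval, Function.update_eq_self, hval] at h
    refine h.trans ?_
    have := (le_abs_self _).trans (hτcon _ (hs i) _ (hs j))
    rw [abs_of_nonneg (sub_nonneg.2 hle)] at this
    gcongr
  have h2 := mul_le_mul_of_nonneg_left h1 (mul_nonneg hβ0 hp0)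
  have h3 := mul_le_mul_of_nonneg_left (mul_le_of_le_one_left hd hβ1) hp0
  linarith

/-- Scheduling nodes with the largest beliefs attains the maximum in the Bellman operator. -/
lemma bellman_eq_actionValue [Fintype ι]
    (hβ0 : 0 ≤ β) (hβ1 : β ≤ 1) (hp0 : 0 ≤ p) (hp1 : p ≤ 1)
    (hB : 0 ≤ B) (hτmap : ∀ x ∈ Set.Icc (0 : ℝ) 1, τ x ∈ Set.Icc (0 : ℝ) 1)
    (hτmono : MonotoneOn τ (Set.Icc 0 1))
    (hτcon : ∀ x ∈ Set.Icc (0 : ℝ) 1, ∀ y ∈ Set.Icc (0 : ℝ) 1, |τ x - τ y| ≤ |x - y|)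
    (hsym : IsPermInvariant F) (hF : HasIncrementBound B F)
    {S : Finset ι} (hS : S.card = K) {s : ι → ℝ} (hs : ∀ i, s i ∈ Set.Icc (0 : ℝ) 1)
    (htop : ∀ i ∈ S, ∀ j ∉ S, s j ≤ s i) :
    bellman K (p * B) β p τ F s = actionValue (p * B) β p τ F S s := by
  refine le_antisymm (bellman_le (hS ▸ Finset.card_le_univ S) fun A hA => ?_)
    (actionValue_le_bellman hS s)
  induction hn : (A \ S).card using Nat.strong_induction_on generalizing A with
  | _ n ih =>
  by_cases hAS : A ⊆ S
  · rw [Finset.eq_of_subset_of_card_le hAS (hS.trans hA.symm).le]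
  have hSA : ¬ S ⊆ A := fun h => hAS
    (Finset.eq_of_subset_of_card_le h (hA.trans hS.symm).le).superset
  obtain ⟨j, hjA, hjS⟩ := Finset.not_subset.1 hAS
  obtain ⟨i, hiS, hiA⟩ := Finset.not_subset.1 hSA
  obtain ⟨C, hjC, rfl⟩ : ∃ C, j ∉ C ∧ insert j C = A :=
    ⟨A.erase j, Finset.notMem_erase j A, Finset.insert_erase hjA⟩
  have hiC : i ∉ C := fun h => hiA (Finset.mem_insert_of_mem h)
  have hij : i ≠ j := fun h => hjS (h ▸ hiS)
  refine (actionValue_exchange hβ0 hβ1 hp0 hp1 hB hτmap hτmono hτcon hsym hF hiC hjC hij hs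
    (htop i hiS j hjS)).trans (ih _ ?_ _ ?_ rfl)
  · rw [← hn, Finset.insert_sdiff_of_mem _ hiS, Finset.insert_sdiff_of_notMem _ hjS,
      Finset.card_insert_of_notMem fun h => hjC (Finset.mem_sdiff.1 h).1]
    exact Nat.lt_succ_self _
  · rw [Finset.card_insert_of_notMem hiC, ← hA, Finset.card_insert_of_notMem hjC]

lemma isPermInvariant_optValue [Fintype ι] (hK : K ≤ Fintype.card ι) (m : ℕ) :
    IsPermInvariant (optValue (ι := ι) K c β p τ m) := by
  induction m with
  | zero => exact fun _ _ => rfl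
  | succ m ih => exact ih.bellman hK

lemma hasIncrementBound_optValue [Fintype ι] (hK : K ≤ Fintype.card ι)
    (hβ0 : 0 ≤ β) (hβ1 : β ≤ 1) (hp0 : 0 ≤ p) (hp1 : p ≤ 1) (hB : 0 ≤ B)
    (hτmap : ∀ x ∈ Set.Icc (0 : ℝ) 1, τ x ∈ Set.Icc (0 : ℝ) 1)
    (hτmono : MonotoneOn τ (Set.Icc 0 1))
    (hτcon : ∀ x ∈ Set.Icc (0 : ℝ) 1, ∀ y ∈ Set.Icc (0 : ℝ) 1, |τ x - τ y| ≤ |x - y|)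
    (m : ℕ) : HasIncrementBound B (optValue (ι := ι) K (p * B) β p τ m) := by
  induction m with
  | zero =>
    intro _ _ _ x _ y _ h
    simpa [optValue] using mul_nonneg hB (sub_nonneg.2 h)
  | succ m ih => exact ih.bellman hK hβ0 hβ1 hp0 hp1 hB hτmap hτmono hτcon

end Bellman

section ListVectors

variable {N K : ℕ}

lemma ofFn_getD {L : List ℝ} (hL : L.length = N) :
    List.ofFn (fun i : Fin N => L.getD i.val 0) = L := by
  subst hL
  refine List.ext_getElem (by simp) fun i _ _ => ?_
  simp

lemma antitone_iff_pairwise_ofFn {v : Fin N → ℝ} :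
    Antitone v ↔ (List.ofFn v).Pairwise (fun a b => b ≤ a) := by
  rw [List.pairwise_ofFn]
  exact ⟨fun h _ _ hij => h hij.le, fun h => antitone_iff_forall_lt.2 fun _ _ hij => h hij⟩

lemma exists_eq_comp_perm_of_ofFn_perm {u v : Fin N → ℝ}
    (h : (List.ofFn u).Perm (List.ofFn v)) : ∃ σ : Equiv.Perm (Fin N), u = v ∘ σ := by
  have hsort : ∀ w : Fin N → ℝ,
      (List.ofFn (w ∘ Tuple.sort w)).Pairwise (fun a b => a ≤ b) := fun w =>
    List.pairwise_ofFn.2 fun i j hij => Tuple.monotone_sort w hij.le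
  have hperm : (List.ofFn (u ∘ Tuple.sort u)).Perm (List.ofFn (v ∘ Tuple.sort v)) :=
    (Equiv.Perm.ofFn_comp_perm _ u).trans (h.trans (Equiv.Perm.ofFn_comp_perm _ v).symm)
  have heq : u ∘ Tuple.sort u = v ∘ Tuple.sort v :=
    List.ofFn_injective (hperm.eq_of_pairwise (fun _ _ _ _ => le_antisymm) (hsort u) (hsort v))
  refine ⟨(Tuple.sort u).symm.trans (Tuple.sort v), ?_⟩
  funext i
  simpa using congrFun heq ((Tuple.sort u).symm i)

lemma pairwise_mergeSort_ge (L : List ℝ) :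
    (L.mergeSort (fun a b => decide (b ≤ a))).Pairwise (fun a b => b ≤ a) := by
  have := List.pairwise_mergeSort (le := fun a b : ℝ => decide (b ≤ a))
    (fun a b c => by simpa using fun h1 h2 => le_trans h2 h1)
    (fun a b => by simpa using le_total b a) L
  simpa using this

lemma ofFn_sortVec (v : Fin N → ℝ) :
    List.ofFn (sortVec N v) = (List.ofFn v).mergeSort (fun a b => decide (b ≤ a)) :=
  ofFn_getD (by simp)

lemma antitone_sortVec (v : Fin N → ℝ) : Antitone (sortVec N v) := by
  rw [antitone_iff_pairwise_ofFn, ofFn_sortVec]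
  exact pairwise_mergeSort_ge _

lemma exists_sortVec_eq_comp (v : Fin N → ℝ) :
    ∃ σ : Equiv.Perm (Fin N), sortVec N v = v ∘ σ :=
  exists_eq_comp_perm_of_ofFn_perm (by
    rw [ofFn_sortVec]
    exact List.mergeSort_perm _ _)

lemma ofFn_nextVec (τ : ℝ → ℝ) (E : Finset (Fin N)) (v : Fin N → ℝ) :
    List.ofFn (nextVec N τ E v) =
      ((((Finset.univ \ E).sort (· ≤ ·)).map v).mergeSort
        (fun a b => decide (b ≤ a))).map τ ++ List.replicate E.card 0 := by
  set L := ((((Finset.univ \ E).sort (· ≤ ·)).map v).mergeSort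
        (fun a b => decide (b ≤ a))).map τ with hL
  have hlen : (L ++ List.replicate E.card (0 : ℝ)).length = N := by
    have := Finset.card_sdiff_add_card_eq_card (Finset.subset_univ E)
    simpa [hL] using this
  rw [← ofFn_getD hlen]
  congr 1
  funext i
  unfold nextVec
  rw [← hL]
  by_cases h : i.val < L.length
  · rw [List.getD_append _ _ _ _ h]
  · rw [List.getD_append_right _ _ _ _ (not_lt.1 h), List.getD_eq_default _ _ (not_lt.1 h)]
    simp only [List.getD_eq_getElem?_getD, List.getElem?_replicate]
    split_ifs <;> rfl

lemma antitone_nextVec {τ : ℝ → ℝ} (E : Finset (Fin N)) {v : Fin N → ℝ}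
    (hτmap : ∀ x ∈ Set.Icc (0 : ℝ) 1, τ x ∈ Set.Icc (0 : ℝ) 1)
    (hτmono : MonotoneOn τ (Set.Icc 0 1))
    (hv : ∀ i, v i ∈ Set.Icc (0 : ℝ) 1) : Antitone (nextVec N τ E v) := by
  rw [antitone_iff_pairwise_ofFn, ofFn_nextVec, List.pairwise_append]
  have hmem : ∀ a ∈ (((Finset.univ \ E).sort (· ≤ ·)).map v).mergeSort
        (fun a b => decide (b ≤ a)), a ∈ Set.Icc (0 : ℝ) 1 := by
    intro a ha
    obtain ⟨i, -, rfl⟩ := List.mem_map.1 (List.mem_mergeSort.1 ha)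
    exact hv i
  refine ⟨?_, ?_, ?_⟩
  · rw [List.pairwise_map]
    exact (pairwise_mergeSort_ge _).imp_of_mem fun ha hb hba =>
      hτmono (hmem _ hb) (hmem _ ha) hba
  · simp [List.pairwise_replicate]
  · intro a ha b hb
    obtain ⟨x, hx, rfl⟩ := List.mem_map.1 ha
    rw [List.eq_of_mem_replicate hb]
    exact (hτmap x (hmem x hx)).1

lemma exists_nextVec_eq_comp (τ : ℝ → ℝ) (E : Finset (Fin N)) (v : Fin N → ℝ) :
    ∃ σ : Equiv.Perm (Fin N), nextVec N τ E v = stepBelief τ E v ∘ σ := by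
  refine exists_eq_comp_perm_of_ofFn_perm ?_
  rw [ofFn_nextVec]
  have hidx : ((Finset.univ \ E).sort (· ≤ ·) ++ E.sort (· ≤ ·)).Perm (List.finRange N) := by
    refine (List.perm_ext_iff_of_nodup ?_ (List.nodup_finRange N)).2 fun i => ?_
    · refine List.nodup_append'.2 ⟨Finset.sort_nodup _ _, Finset.sort_nodup _ _, ?_⟩
      intro i hi hi'
      simp_all
    · simp [em']
  rw [List.ofFn_eq_map]
  refine List.Perm.trans ?_ (hidx.map (stepBelief τ E v))
  rw [List.map_append]
  refine List.Perm.append (((List.mergeSort_perm _ _).map τ).trans (List.Perm.of_eq ?_))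
    (List.Perm.of_eq ?_)
  · rw [List.map_map]
    refine List.map_congr_left fun i hi => ?_
    have : i ∉ E := by simpa using hi
    simp [stepBelief, this]
  · rw [eq_comm, List.eq_replicate_iff]
    refine ⟨by simp, fun b hb => ?_⟩
    obtain ⟨i, hi, rfl⟩ := List.mem_map.1 hb
    have : i ∈ E := by simpa using hi
    simp [stepBelief, this]

lemma sum_restr {A : Finset (Fin N)} (hA : A.card = K) (s : Fin N → ℝ) :
    ∑ k, restr N K A s k = ∑ i ∈ A, s i := by
  unfold restr
  rw [← List.sum_ofFn, ofFn_getD (by simp [hA])]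
  conv_rhs => rw [← Finset.sort_toFinset A (· ≤ ·)]
  rw [List.sum_toFinset _ (Finset.sort_nodup A (· ≤ ·))]

lemma sched_eq_map (hKN : K ≤ N) :
    sched N K = Finset.univ.map (Fin.castLEEmb hKN) := by
  ext i
  simp only [sched, Finset.mem_filter, Finset.mem_univ, true_and, Finset.mem_map,
    Fin.castLEEmb_apply]
  exact ⟨fun h => ⟨⟨i, h⟩, rfl⟩, by rintro ⟨k, rfl⟩; exact k.2⟩

lemma card_sched (hKN : K ≤ N) : (sched N K).card = K := by
  simp [sched_eq_map hKN]

lemma sum_firstK (hKN : K ≤ N) (v : Fin N → ℝ) :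
    ∑ k, firstK N K v k = ∑ i ∈ sched N K, v i := by
  rw [sched_eq_map hKN, Finset.sum_map]
  refine Finset.sum_congr rfl fun k _ => ?_
  have hk : k.val < N := k.2.trans_le hKN
  simp [firstK, hk, Fin.castLE]

end ListVectors

section Policies

variable {N K : ℕ} {β p B : ℝ} {τ : ℝ → ℝ}

/-- On sorted belief vectors the pseudo value function is the optimal value function. -/
lemma W_eq_optValue (hKN : K ≤ N)
    (hβ0 : 0 ≤ β) (hβ1 : β ≤ 1) (hp0 : 0 ≤ p) (hp1 : p ≤ 1) (hB : 0 ≤ B)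
    (hτmap : ∀ x ∈ Set.Icc (0 : ℝ) 1, τ x ∈ Set.Icc (0 : ℝ) 1)
    (hτmono : MonotoneOn τ (Set.Icc 0 1))
    (hτcon : ∀ x ∈ Set.Icc (0 : ℝ) 1, ∀ y ∈ Set.Icc (0 : ℝ) 1, |τ x - τ y| ≤ |x - y|)
    (m : ℕ) {v : Fin N → ℝ} (hv : ∀ i, v i ∈ Set.Icc (0 : ℝ) 1) (hanti : Antitone v) :
    W N K β p τ (fun x => p * B * ∑ k, x k) m v = optValue K (p * B) β p τ (m + 1) v := by
  have hcard : K ≤ Fintype.card (Fin N) := by simpa using hKN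
  have hopt : ∀ n (u : Fin N → ℝ), (∀ i, u i ∈ Set.Icc (0 : ℝ) 1) → Antitone u →
      optValue K (p * B) β p τ (n + 1) u
        = actionValue (p * B) β p τ (optValue K (p * B) β p τ n) (sched N K) u := by
    intro n u hu hanti
    refine bellman_eq_actionValue hβ0 hβ1 hp0 hp1 hB hτmap hτmono hτcon
      (isPermInvariant_optValue hcard n)
      (hasIncrementBound_optValue hcard hβ0 hβ1 hp0 hp1 hB hτmap hτmono hτcon n)
      (card_sched hKN) hu fun i hi j hj => ?_
    simp only [sched, Finset.mem_filter, Finset.mem_univ, true_and, not_lt] at hi hj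
    exact hanti (Fin.le_def.2 (hi.le.trans hj))
  induction m generalizing v with
  | zero =>
    rw [hopt 0 v hv hanti]
    simp [W, actionValue, activeExp, optValue, sum_firstK hKN]
  | succ m ih =>
    rw [hopt (m + 1) v hv hanti]
    simp only [W, actionValue, activeExp, sum_firstK hKN, card_sched hKN]
    congr 2
    refine Finset.sum_congr rfl fun E _ => ?_
    congr 1
    obtain ⟨σ, hσ⟩ := exists_nextVec_eq_comp τ E v
    rw [ih (fun i => hσ ▸ stepBelief_mem hτmap E hv (σ i))
      (antitone_nextVec E hτmap hτmono hv), hσ, isPermInvariant_optValue hcard]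

/-- No policy exceeds the optimal value function. -/
lemma Vpol_le_optValue (T : ℕ) (hβ0 : 0 ≤ β) (hp0 : 0 ≤ p) (hp1 : p ≤ 1)
    {pol : ℕ → (Fin N → ℝ) → Finset (Fin N)} (hpol : ∀ m s, (pol m s).card = K)
    (m : ℕ) (s : Fin N → ℝ) :
    Vpol N K T β p τ (fun x => p * B * ∑ k, x k) pol m s
      ≤ optValue K (p * B) β p τ (m + 1) s := by
  induction m generalizing s with
  | zero =>
    refine le_trans (le_of_eq ?_) (actionValue_le_bellman (hpol T s) s)
    simp [Vpol, actionValue, activeExp, optValue, sum_restr (hpol _ _)]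
  | succ m ih =>
    refine le_trans ?_ (actionValue_le_bellman (hpol (T - (m + 1)) s) s)
    have h := mul_le_mul_of_nonneg_left (activeExp_mono hp0 hp1
      (A := pol (T - (m + 1)) s) fun E _ => ih (stepBelief τ E s)) hβ0
    simp only [activeExp, hpol] at h
    simp only [Vpol, actionValue, activeExp, sum_restr (hpol _ _), hpol]
    exact add_le_add_right h _

end Policies

/-- Theorem 2: for the sum-throughput reward `R(v_1,…,v_K) = p·B·Σ_{i=1}^K v_i` (regular and
bounded with `Δl = Δu = p·B`), if `τ` is a monotonically increasing contracting map and
`β ∈ (0,1]`, then the myopic policy is optimal: for every scheduling policy, every time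
`1 ≤ n ≤ T` and every belief vector `s`, `V^π_n(s) ≤ W_n(sort s)`. -/
theorem myopic_policy_optimal_sum_throughput
    (N K T : ℕ) (hK : 1 ≤ K) (hKN : K ≤ N) (hT : 1 ≤ T)
    (β p B : ℝ) (hβ0 : 0 < β) (hβ1 : β ≤ 1) (hp0 : 0 ≤ p) (hp1 : p ≤ 1) (hB : 0 < B)
    (τ : ℝ → ℝ)
    (hτmap : ∀ x ∈ Set.Icc (0 : ℝ) 1, τ x ∈ Set.Icc (0 : ℝ) 1)
    (hτmono : ∀ x ∈ Set.Icc (0 : ℝ) 1, ∀ y ∈ Set.Icc (0 : ℝ) 1, y < x → τ y < τ x)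
    (hτcon : ∀ x ∈ Set.Icc (0 : ℝ) 1, ∀ y ∈ Set.Icc (0 : ℝ) 1, |τ x - τ y| ≤ |x - y|)
    (R : (Fin K → ℝ) → ℝ) (hR : R = fun x => p * B * ∑ k, x k) :
    ∀ pol : ℕ → (Fin N → ℝ) → Finset (Fin N),
      (∀ m s, (pol m s).card = K) →
      ∀ n : ℕ, 1 ≤ n → n ≤ T →
      ∀ s : Fin N → ℝ, (∀ i, s i ∈ Set.Icc (0 : ℝ) 1) →
        Vpol N K T β p τ R pol (T - n) s ≤ W N K β p τ R (T - n) (sortVec N s) := by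
  intro pol hpol n _ _ s hs
  subst hR
  have hτmono' : MonotoneOn τ (Set.Icc 0 1) :=
    StrictMonoOn.monotoneOn fun y hy x hx hyx => hτmono x hx y hy hyx
  obtain ⟨σ, hσ⟩ := exists_sortVec_eq_comp s
  rw [W_eq_optValue hKN hβ0.le hβ1 hp0 hp1 hB.le hτmap hτmono' hτcon (T - n)
      (fun i => hσ ▸ hs (σ i)) (antitone_sortVec s), hσ,
    isPermInvariant_optValue (by simpa using hKN)]
  exact Vpol_le_optValue T hβ0.le hp0 hp1 hpol (T - n) s
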